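/- arXiv:1209.5993 — 2 statements merged into one kernel-verified Lean document; each statement's English description precedes it below -/
import Mathlib

section
/- Let K be a field of characteristic zero, let k, r ≥ 1, and let X₁,…,X_r be generic k×k matrices (matrices of independent commuting indeterminates). Call two nonempty words with entries in {1,…,r} equivalent if one is a cyclic rotation of the other; the trace polynomial T_α(X) = trace(X_{i₁}⋯X_{i_l}) depends only on the equivalence class [α]. Then the polynomials T_{[α]}(X), as [α] ranges over all equivalence classes of words of length l with 1 ≤ l ≤ k, are linearly independent over K. -/
open MvPolynomial Matrix

/-- The `i`-th generic `k × k` matrix over `K`: its `(a, b)` entry is the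
variable `X (i, a, b)` of the polynomial ring in the `r·k²` matrix entries. -/
noncomputable def genericMatrix (K : Type*) [CommSemiring K] (r k : ℕ) (i : Fin r) :
    Matrix (Fin k) (Fin k) (MvPolynomial (Fin r × Fin k × Fin k) K) :=
  Matrix.of fun a b => MvPolynomial.X (i, a, b)

/-- Nonempty words with entries in `{1, …, r}` of length at most `k`. -/
abbrev TraceWord (r k : ℕ) := {w : List (Fin r) // w ≠ [] ∧ w.length ≤ k}

/-- Cyclic-rotation relation on words: `w'` is obtained from `w` by a cyclic rotation. -/
def CyclicRel (r k : ℕ) (w w' : TraceWord r k) : Prop :=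
  ∃ n : ℕ, (w' : List (Fin r)) = (w : List (Fin r)).rotate n

/-- The exponent vector of the monomial `∏ j, X (w j, v j, v (j + 1))` attached to a word `w`
and a sequence of vertices `v`. -/
noncomputable def walkExponent {r k : ℕ} (w : List (Fin r)) (v : ℕ → Fin k) :
    (Fin r × Fin k × Fin k) →₀ ℕ :=
  ∑ j : Fin w.length, Finsupp.single (w[j], v j, v (j + 1)) 1

theorem walkExponent_cons {r k : ℕ} (i : Fin r) (w : List (Fin r)) (v : ℕ → Fin k) :
    walkExponent (i :: w) v =
      Finsupp.single (i, v 0, v 1) 1 + walkExponent w (fun j => v (j + 1)) := by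
  simp [walkExponent, Fin.sum_univ_succ]

theorem degree_walkExponent {r k : ℕ} (w : List (Fin r)) (v : ℕ → Fin k) :
    (walkExponent w v).degree = w.length := by
  simp [walkExponent]

theorem walkExponent_apply_ne_zero_iff {r k : ℕ} (w : List (Fin r)) (v : ℕ → Fin k)
    (e : Fin r × Fin k × Fin k) :
    walkExponent w v e ≠ 0 ↔ ∃ j : Fin w.length, (w[j], v j, v (j + 1)) = e := by
  simp [walkExponent, Finsupp.finsetSum_apply, Finsupp.single_apply]

/-- The monomials occurring in an entry of a product of generic matrices are those of the walks
between the two indices. -/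
theorem coeff_prod_genericMatrix_ne_zero_iff {r k : ℕ} (w : List (Fin r)) (a b : Fin k)
    (m : (Fin r × Fin k × Fin k) →₀ ℕ) :
    coeff m ((w.map (genericMatrix ℕ r k)).prod a b) ≠ 0 ↔
      ∃ v : ℕ → Fin k, v 0 = a ∧ v w.length = b ∧ m = walkExponent w v := by
  induction w generalizing a m with
  | nil =>
    by_cases hab : a = b
    · subst hab
      simp only [List.map_nil, List.prod_nil, Matrix.one_apply_eq, coeff_one, walkExponent]
      constructor
      · intro h
        exact ⟨fun _ => a, rfl, rfl, by simpa [eq_comm] using h⟩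
      · rintro ⟨v, -, -, h⟩
        simpa [eq_comm] using h
    · simp only [List.map_nil, List.prod_nil, Matrix.one_apply_ne hab, coeff_zero, ne_eq,
        not_true_eq_false, false_iff]
      rintro ⟨v, h0, h1, -⟩
      exact hab (h0.symm.trans h1)
  | cons i w ih =>
    simp only [List.map_cons, List.prod_cons, Matrix.mul_apply, coeff_sum, ne_eq,
      Finset.sum_eq_zero_iff, Finset.mem_univ, true_imp_iff, not_forall, genericMatrix,
      Matrix.of_apply, coeff_X_mul', ite_eq_right_iff, exists_prop]
    constructor
    · rintro ⟨c, hc, h⟩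
      obtain ⟨v, h0, h1, h2⟩ := (ih c _).1 h
      refine ⟨fun j => Nat.casesOn j a v, rfl, h1, ?_⟩
      rw [walkExponent_cons]
      change m = Finsupp.single (i, a, v 0) 1 + walkExponent w v
      rw [← h2, h0, add_tsub_cancel_of_le]
      rw [Finsupp.single_le_iff]
      exact Nat.one_le_iff_ne_zero.2 (Finsupp.mem_support_iff.1 hc)
    · rintro ⟨v, rfl, h1, rfl⟩
      refine ⟨v 1, ?_, (ih _ _).2 ⟨fun j => v (j + 1), rfl, h1, ?_⟩⟩
      · simp [walkExponent_cons]
      · rw [walkExponent_cons, add_tsub_cancel_left]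

theorem coeff_trace_prod_genericMatrix_ne_zero_iff {r k : ℕ} (w : List (Fin r))
    (m : (Fin r × Fin k × Fin k) →₀ ℕ) :
    coeff m (Matrix.trace (w.map (genericMatrix ℕ r k)).prod) ≠ 0 ↔
      ∃ v : ℕ → Fin k, v w.length = v 0 ∧ m = walkExponent w v := by
  simp only [Matrix.trace, Matrix.diag_apply, coeff_sum, ne_eq, Finset.sum_eq_zero_iff,
    Finset.mem_univ, true_imp_iff, not_forall]
  simp only [← ne_eq, coeff_prod_genericMatrix_ne_zero_iff]
  constructor
  · rintro ⟨a, v, rfl, h⟩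
    exact ⟨v, h⟩
  · rintro ⟨v, h⟩
    exact ⟨v 0, v, rfl, h⟩

theorem map_trace_prod_genericMatrix (K : Type*) [CommSemiring K] {r k : ℕ} (w : List (Fin r)) :
    MvPolynomial.map (Nat.castRingHom K) (Matrix.trace (w.map (genericMatrix ℕ r k)).prod) =
      Matrix.trace (w.map (genericMatrix K r k)).prod := by
  have h : ∀ i, (MvPolynomial.map (Nat.castRingHom K)).mapMatrix (genericMatrix ℕ r k i) =
      genericMatrix K r k i := by
    intro i
    ext a b : 2
    simp [genericMatrix]
  rw [AddMonoidHom.map_trace, ← RingHom.mapMatrix_apply, map_list_prod, List.map_map]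
  simp only [Function.comp_def, h]

/-- Coefficients of trace monomials are natural numbers, so in characteristic zero they vanish
only if no closed walk contributes. -/
theorem coeff_trace_prod_genericMatrix_ne_zero_iff_of_charZero (K : Type*) [CommSemiring K]
    [CharZero K] {r k : ℕ} (w : List (Fin r)) (m : (Fin r × Fin k × Fin k) →₀ ℕ) :
    coeff m (Matrix.trace (w.map (genericMatrix K r k)).prod) ≠ 0 ↔
      ∃ v : ℕ → Fin k, v w.length = v 0 ∧ m = walkExponent w v := by
  rw [← map_trace_prod_genericMatrix, coeff_map, ← coeff_trace_prod_genericMatrix_ne_zero_iff]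
  simp

/-- The walk going around the cycle `0 → 1 → ⋯ → w.length - 1 → 0`. -/
def TraceWord.cycle {r k : ℕ} (w : TraceWord r k) (j : ℕ) : Fin k :=
  ⟨j % w.1.length, (Nat.mod_lt _ (List.length_pos_iff.2 w.2.1)).trans_le w.2.2⟩

/-- The exponent of the cyclic walk determines the word up to rotation. -/
theorem TraceWord.eq_rotate_of_walkExponent_cycle_eq {r k : ℕ} (w : TraceWord r k)
    (u : List (Fin r)) (v : ℕ → Fin k) (h : walkExponent w.1 w.cycle = walkExponent u v) :
    u = w.1.rotate (v 0) := by
  have hlen : w.1.length = u.length := by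
    rw [← degree_walkExponent w.1 w.cycle, h, degree_walkExponent]
  have edge : ∀ j (hj : j < u.length), ∃ i : Fin w.1.length,
      u[j] = w.1[i] ∧ (v j : ℕ) = i ∧ (v (j + 1) : ℕ) = (i + 1) % w.1.length := by
    intro j hj
    have hne : walkExponent w.1 w.cycle (u[j], v j, v (j + 1)) ≠ 0 := by
      rw [h, walkExponent_apply_ne_zero_iff]
      exact ⟨⟨j, hj⟩, rfl⟩
    obtain ⟨i, hi⟩ := (walkExponent_apply_ne_zero_iff _ _ _).1 hne
    simp only [Prod.mk.injEq] at hi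
    obtain ⟨h1, h2, h3⟩ := hi
    refine ⟨i, h1.symm, ?_, ?_⟩
    · rw [← h2]
      exact Nat.mod_eq_of_lt i.2
    · rw [← h3]
      rfl
  have vertex : ∀ j, j < u.length → (v j : ℕ) = (j + v 0) % w.1.length := by
    intro j
    induction j with
    | zero =>
      intro hj
      obtain ⟨i, -, hi, -⟩ := edge 0 hj
      rw [zero_add, hi, Nat.mod_eq_of_lt i.2]
    | succ j ih =>
      intro hj
      obtain ⟨i, -, hi, hi'⟩ := edge j (by omega)
      rw [hi', ← hi, ih (by omega), Nat.mod_add_mod]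
      congr 1
      omega
  refine List.ext_getElem (by simp [hlen]) fun j hj hj' => ?_
  obtain ⟨i, hu, hi, -⟩ := edge j hj
  rw [hu, List.getElem_rotate]
  simp only [Fin.getElem_fin, ← hi, vertex j hj]

/-- The trace polynomials `T_α(X) = trace(X_{i₁} ⋯ X_{i_l})` of generic `k × k`
matrices, one for each cyclic-equivalence class of nonempty words of length at
most `k` (with an arbitrary representative chosen via `Quot.out` for each class),
are linearly independent over a field `K` of characteristic zero. -/
theorem trace_monomials_linearIndependent (K : Type*) [Field K] [CharZero K]
    (k r : ℕ) (hk : 1 ≤ k) (hr : 1 ≤ r) :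
    LinearIndependent K
      (fun q : Quot (CyclicRel r k) =>
        Matrix.trace (((Quot.out q : TraceWord r k) : List (Fin r)).map
          (genericMatrix K r k)).prod) := by
  rw [linearIndependent_iff']
  intro s g hg q hq
  let w : TraceWord r k := Quot.out q
  have hcoeff := congrArg (coeff (walkExponent w.1 w.cycle)) hg
  rw [coeff_sum, coeff_zero, Finset.sum_eq_single_of_mem q hq, coeff_smul, smul_eq_mul] at hcoeff
  · refine (mul_eq_zero.1 hcoeff).resolve_right ?_
    rw [← ne_eq, coeff_trace_prod_genericMatrix_ne_zero_iff_of_charZero]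
    exact ⟨w.cycle, by simp [TraceWord.cycle, w], rfl⟩
  · intro p _ hpq
    rw [coeff_smul, smul_eq_mul]
    refine mul_eq_zero_of_right _ ?_
    by_contra hne
    obtain ⟨v, -, hv⟩ := (coeff_trace_prod_genericMatrix_ne_zero_iff_of_charZero K _ _).1 hne
    have hrel : CyclicRel r k w p.out := ⟨v 0, w.eq_rotate_of_walkExponent_cycle_eq _ v hv⟩
    exact hpq (by rw [← Quot.out_eq p, ← Quot.out_eq q]; exact (Quot.sound hrel).symm)
end

section
/- Let K be an algebraically closed field of characteristic zero, m, r ≥ 1, and let A = (A₁,…,A_r) and A′ = (A′₁,…,A′_r) be two r-tuples of m×m matrices over K. Then every SL_m-invariant polynomial takes equal values at A and A′ (that is, f(A) = f(A′) for every polynomial f in the r·m² matrix entries satisfying f(PB₁P⁻¹,…,PB_rP⁻¹) = f(B₁,…,B_r) for all P ∈ SL_m(K) and all tuples B) if and only if trace(A_{i₁}⋯A_{i_l}) = trace(A′_{i₁}⋯A′_{i_l}) for every word (i₁,…,i_l) with entries in {1,…,r} of length l ≤ m². -/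
open MvPolynomial Matrix

/-- `f` is an `SL_m`-invariant: `f(PB₁P⁻¹, …, PB_rP⁻¹) = f(B₁, …, B_r)` for every
`P ∈ SL_m(K)` and every tuple of `m × m` matrices `B₁, …, B_r` over `K`. -/
def IsMatrixInvariant (K : Type*) [Field K] (r m : ℕ)
    (f : MvPolynomial (Fin r × Fin m × Fin m) K) : Prop :=
  ∀ (P : Matrix.SpecialLinearGroup (Fin m) K) (B : Fin r → Matrix (Fin m) (Fin m) K),
    MvPolynomial.eval
        (fun p : Fin r × Fin m × Fin m => (P.1 * B p.1 * (P⁻¹).1) p.2.1 p.2.2) f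
      = MvPolynomial.eval (fun p : Fin r × Fin m × Fin m => B p.1 p.2.1 p.2.2) f

/-- The trace of the permutation `σ` acting on tensors, composed with `⨂ X k`: the product over the
cycles `(k, σ k, σ² k, …)` of `σ` of the traces of `X k * X (σ k) * X (σ² k) * ⋯`. -/
def permTrace {R ι n : Type*} [CommRing R] [Fintype ι] [DecidableEq ι] [Fintype n]
    (σ : Equiv.Perm ι) (X : ι → Matrix n n R) : R :=
  ∑ j : ι → n, ∏ k, X k (j k) (j (σ k))

section PermTrace

variable {R ι κ n : Type*} [CommRing R] [Fintype ι] [DecidableEq ι] [Fintype κ] [DecidableEq κ]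
  [Fintype n]

theorem permTrace_reindex (e : κ ≃ ι) (σ : Equiv.Perm ι) (τ : Equiv.Perm κ)
    (h : ∀ k, e (τ k) = σ (e k)) (X : ι → Matrix n n R) :
    permTrace σ X = permTrace τ (X ∘ e) := by
  unfold permTrace
  refine Fintype.sum_equiv (e.arrowCongr (Equiv.refl n)).symm _ _ fun j => ?_
  rw [← e.prod_comp]
  refine Finset.prod_congr rfl fun k _ => ?_
  simp [Equiv.arrowCongr, h]

theorem permTrace_eq_mul_subtypePerm (σ : Equiv.Perm ι) (p : ι → Prop) [DecidablePred p]
    (hp : ∀ k, p (σ k) ↔ p k) (X : ι → Matrix n n R) :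
    permTrace σ X = permTrace (σ.subtypePerm hp) (fun k => X k) *
      permTrace (σ.subtypePerm (p := fun k => ¬ p k) fun k => not_congr (hp k)) (fun k => X k) := by
  unfold permTrace
  rw [Fintype.sum_mul_sum, ← Fintype.sum_prod_type']
  refine Fintype.sum_equiv (Equiv.piEquivPiSubtypeProd p fun _ => n) _ _ fun j => ?_
  rw [← Fintype.prod_subtype_mul_prod_subtype p]
  rfl

theorem prod_ofFn_apply [DecidableEq n] (d : ℕ) (X : Fin (d + 1) → Matrix n n R) (a b : n) :
    (List.ofFn X).prod a b = ∑ j : Fin d → n,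
      ∏ k, X k (Fin.cons (α := fun _ => n) a j k) (Fin.snoc (α := fun _ => n) j b k) := by
  induction d generalizing a b with
  | zero => simp [Fin.snoc]
  | succ d ih =>
    rw [List.ofFn_succ, List.prod_cons, Matrix.mul_apply,
      ← (Fin.consEquiv fun _ : Fin (d + 1) => n).sum_comp, Fintype.sum_prod_type]
    refine Finset.sum_congr rfl fun c _ => ?_
    rw [ih, Finset.mul_sum]
    refine Finset.sum_congr rfl fun j _ => ?_
    rw [Fin.prod_univ_succ (n := d + 1)]
    congr 1
    refine Finset.prod_congr rfl fun k _ => ?_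
    have hsnoc : Fin.snoc (α := fun _ => n) (Fin.cons (α := fun _ => n) c j) b k.succ =
        Fin.snoc (α := fun _ => n) j b k := by
      rw [← Fin.cons_snoc_eq_snoc_cons, Fin.cons_succ]
    exact congrArg _ hsnoc.symm

theorem permTrace_finRotate [DecidableEq n] (d : ℕ) (X : Fin (d + 1) → Matrix n n R) :
    permTrace (finRotate (d + 1)) X = trace (List.ofFn X).prod := by
  unfold permTrace trace
  rw [← (Fin.consEquiv fun _ : Fin (d + 1) => n).sum_comp, Fintype.sum_prod_type]
  refine Finset.sum_congr rfl fun a _ => ?_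
  rw [Matrix.diag_apply, prod_ofFn_apply]
  simp only [Fin.consEquiv_apply, Fin.snoc_eq_cons_rotate]

/-- A transitive permutation is conjugate to the standard cycle. -/
theorem isConj_finRotate_of_sameCycle {d : ℕ} (σ : Equiv.Perm (Fin (d + 1)))
    (h : ∀ x, σ.SameCycle 0 x) : IsConj (finRotate (d + 1)) σ := by
  cases d with
  | zero => rw [Subsingleton.elim (finRotate 1) σ]
  | succ d =>
    have hne : ∀ x, σ x ≠ x := by
      intro x hx
      obtain ⟨y, hy⟩ := exists_ne x
      have hxy : σ.SameCycle x y := (h x).symm.trans (h y)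
      obtain ⟨i, hi⟩ := hxy
      exact hy (by rw [← hi, Equiv.Perm.zpow_apply_eq_self_of_apply_eq_self hx])
    have hcyc : σ.IsCycle := ⟨0, hne 0, fun y _ => h y⟩
    rw [Equiv.Perm.IsCycle.isConj_iff isCycle_finRotate hcyc, support_finRotate]
    congr 1
    ext x
    simp [hne]

theorem permTrace_eq_trace_of_isConj [DecidableEq n] {d : ℕ} (σ : Equiv.Perm (Fin (d + 1)))
    (h : IsConj (finRotate (d + 1)) σ) :
    ∃ e : Equiv.Perm (Fin (d + 1)), ∀ X : Fin (d + 1) → Matrix n n R,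
      permTrace σ X = trace (List.ofFn (X ∘ e)).prod := by
  obtain ⟨c, rfl⟩ := isConj_iff.1 h
  refine ⟨c, fun X => ?_⟩
  rw [permTrace_reindex c _ (finRotate (d + 1)) (by simp), permTrace_finRotate]

end PermTrace

section Reduction

variable {K : Type*} [Field K]

/-- If `σ` is not transitive then its trace is a product of traces of smaller permutations. -/
theorem permTrace_congr_of_not_isConj {n α : Type*} [Fintype n]
    {A A' : α → Matrix n n K} {d : ℕ}
    (h : ∀ e ≤ d, ∀ (u : Fin e → α) (σ : Equiv.Perm (Fin e)),
      permTrace σ (A ∘ u) = permTrace σ (A' ∘ u))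
    (u : Fin (d + 1) → α) (σ : Equiv.Perm (Fin (d + 1)))
    (hσ : ¬ IsConj (finRotate (d + 1)) σ) :
    permTrace σ (A ∘ u) = permTrace σ (A' ∘ u) := by
  classical
  have key : ∀ (p : Fin (d + 1) → Prop) [DecidablePred p] (x : Fin (d + 1)), ¬ p x →
      ∀ τ : Equiv.Perm {k // p k},
        permTrace τ (fun k => (A ∘ u) k) = permTrace τ (fun k => (A' ∘ u) k) := by
    intro p _ x hx τ
    let e := (Fintype.equivFin {k // p k}).symm
    have hcard : Fintype.card {k // p k} ≤ d := by
      have := Fintype.card_subtype_lt hx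
      simp at this ⊢
      omega
    have hc : ∀ k, e ((e.trans (τ.trans e.symm)) k) = τ (e k) := by simp
    rw [permTrace_reindex e _ _ hc, permTrace_reindex e _ _ hc]
    exact h _ hcard (fun k => u (e k)) _
  have hns : ∃ x, ¬ σ.SameCycle 0 x := by
    by_contra! hall
    exact hσ (isConj_finRotate_of_sameCycle σ hall)
  obtain ⟨x, hx⟩ := hns
  have hp : ∀ k, σ.SameCycle 0 (σ k) ↔ σ.SameCycle 0 k := fun k =>
    Equiv.Perm.sameCycle_apply_right
  rw [permTrace_eq_mul_subtypePerm σ _ hp, permTrace_eq_mul_subtypePerm σ _ hp, key _ x hx,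
    key _ 0 (by simp [Equiv.Perm.SameCycle.refl])]

theorem permTrace_congr_of_trace {n α : Type*} [Fintype n] [DecidableEq n]
    {A A' : α → Matrix n n K} (N : ℕ)
    (h : ∀ w : List α, w ≠ [] → w.length ≤ N → trace (w.map A).prod = trace (w.map A').prod) :
    ∀ d ≤ N, ∀ (u : Fin d → α) (σ : Equiv.Perm (Fin d)),
      permTrace σ (A ∘ u) = permTrace σ (A' ∘ u) := by
  intro d
  induction d using Nat.strong_induction_on with
  | _ d ih =>
    intro hd u σ
    cases d with
    | zero => simp [permTrace]
    | succ d =>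
      by_cases hσ : IsConj (finRotate (d + 1)) σ
      · obtain ⟨e, he⟩ := permTrace_eq_trace_of_isConj (n := n) (R := K) σ hσ
        rw [he, he]
        have := h (List.ofFn (u ∘ e)) (by simp) (by simpa using hd)
        rwa [List.map_ofFn, List.map_ofFn] at this
      · exact permTrace_congr_of_not_isConj (fun e he => ih e (by omega) (by omega)) u σ hσ

/-- The alternating sum over `S_d` vanishes on `d`-tensors over a set with fewer than `d`
elements. -/
theorem sum_sign_ite_comp_eq_zero {R β ι : Type*} [CommRing R] [DecidableEq β] [Fintype β]
    [Fintype ι] [DecidableEq ι]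
    (hcard : Fintype.card β < Fintype.card ι) (a b : ι → β) :
    ∑ σ : Equiv.Perm ι, ((Equiv.Perm.sign σ : ℤ) : R) * (if b = a ∘ σ then 1 else 0) = 0 := by
  obtain ⟨x, y, hxy, hab⟩ := Fintype.exists_ne_map_eq_of_card_lt a hcard
  refine Finset.sum_involution (fun σ _ => Equiv.swap x y * σ) ?_ ?_ ?_ ?_
  · intro σ _
    have hsw : a ∘ (Equiv.swap x y * σ : Equiv.Perm ι) = a ∘ σ := by
      funext k
      simp only [Function.comp_apply, Equiv.Perm.mul_apply]
      rw [Equiv.swap_apply_def]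
      split_ifs with h1 h2
      · rw [h1, hab]
      · rw [h2, hab]
      · rfl
    rw [hsw, ← add_mul]
    simp [Equiv.Perm.sign_swap hxy]
  · intro σ _ _ h
    exact hxy (Equiv.swap_eq_one_iff.1 (mul_eq_right.1 h))
  · simp
  · intro σ _
    simp [← mul_assoc]

/-- A tuple of more than `n²` matrices has all its permutation traces determined by those of the
intransitive permutations. -/
theorem permTrace_congr_of_card_lt [CharZero K] {n : Type*} [Fintype n] [DecidableEq n] {d : ℕ}
    (hd : Fintype.card n ^ 2 < d + 1) (X Y : Fin (d + 1) → Matrix n n K)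
    (h : ∀ σ : Equiv.Perm (Fin (d + 1)), ¬ IsConj (finRotate (d + 1)) σ →
      permTrace σ X = permTrace σ Y) (σ : Equiv.Perm (Fin (d + 1))) :
    permTrace σ X = permTrace σ Y := by
  let c : (Fin (d + 1) → n) → (Fin (d + 1) → n) → K := fun a b =>
    ∏ k, X k (a k) (b k) - ∏ k, Y k (a k) (b k)
  let δ : Equiv.Perm (Fin (d + 1)) → K := fun σ => permTrace σ X - permTrace σ Y
  have hδ : ∀ τ, δ τ = ∑ a : (Fin (d + 1) → n), ∑ b : (Fin (d + 1) → n),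
      c a b * (if b = a ∘ τ then 1 else 0) := by
    intro τ
    simp only [δ, c, permTrace, mul_ite, mul_one, mul_zero, Finset.sum_ite_eq', Finset.mem_univ,
      if_true, Finset.sum_sub_distrib, Function.comp_apply]
  have hsign : ∀ τ, ((Equiv.Perm.sign τ : ℤ) : K) * δ τ =
      ((Equiv.Perm.sign (finRotate (d + 1)) : ℤ) : K) * δ τ := by
    intro τ
    by_cases hτ : IsConj (finRotate (d + 1)) τ
    · obtain ⟨g, rfl⟩ := isConj_iff.1 hτ
      rw [Equiv.Perm.sign_mul, Equiv.Perm.sign_mul, Equiv.Perm.sign_inv, mul_right_comm,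
        Int.units_mul_self, one_mul]
    · simp [δ, h τ hτ]
  have horth : ∀ a b : (Fin (d + 1) → n), ∑ τ, δ τ * (if b = a ∘ τ then 1 else 0) = 0 := by
    intro a b
    have h0 : ∑ τ, ((Equiv.Perm.sign τ : ℤ) : K) * δ τ * (if b = a ∘ τ then 1 else 0) = 0 := by
      simp_rw [hδ, Finset.mul_sum, Finset.sum_mul]
      rw [Finset.sum_comm]
      refine Finset.sum_eq_zero fun a' _ => ?_
      rw [Finset.sum_comm]
      refine Finset.sum_eq_zero fun b' _ => ?_
      have := sum_sign_ite_comp_eq_zero (R := K) (β := n × n) (ι := Fin (d + 1))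
        (by simpa [← sq] using hd) (fun k => (a k, a' k)) (fun k => (b k, b' k))
      refine Eq.trans ?_ ((congrArg (c a' b' * ·) this).trans (mul_zero _))
      rw [Finset.mul_sum]
      refine Finset.sum_congr rfl fun τ _ => ?_
      have hiff : ((fun k => (b k, b' k)) = (fun k => (a k, a' k)) ∘ τ) ↔
          (b = a ∘ τ ∧ b' = a' ∘ τ) := by
        simp only [_root_.funext_iff, Function.comp_apply, Prod.mk.injEq, forall_and]
      rw [if_congr hiff rfl rfl]
      by_cases h1 : b = a ∘ τ <;> by_cases h2 : b' = a' ∘ τ <;> simp [h1, h2, mul_comm]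
    simp_rw [hsign, mul_assoc] at h0
    rw [← Finset.mul_sum] at h0
    refine (mul_eq_zero.1 h0).resolve_left ?_
    rcases Int.units_eq_one_or (Equiv.Perm.sign (finRotate (d + 1))) with h1 | h1 <;> rw [h1] <;>
      simp
  -- `δ` lies in the span of rational vectors to which it is orthogonal.
  have hzero : ∀ φ : K →ₗ[ℚ] ℚ, ∀ τ, φ (δ τ) = 0 := by
    intro φ
    have h1 : ∀ a b : (Fin (d + 1) → n), ∑ τ, φ (δ τ) * (if b = a ∘ τ then 1 else 0) = 0 := by
      intro a b
      refine Eq.trans ?_ ((congrArg φ (horth a b)).trans (map_zero φ))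
      rw [map_sum]
      refine Finset.sum_congr rfl fun τ _ => ?_
      split_ifs <;> simp
    have h2 : ∀ τ, φ (δ τ) = ∑ a : (Fin (d + 1) → n), ∑ b : (Fin (d + 1) → n),
        φ (c a b) * (if b = a ∘ τ then 1 else 0) := by
      intro τ
      rw [hδ, map_sum]
      refine Finset.sum_congr rfl fun a _ => ?_
      rw [map_sum]
      refine Finset.sum_congr rfl fun b _ => ?_
      split_ifs <;> simp
    have h3 : ∑ τ, φ (δ τ) * φ (δ τ) = 0 := by
      have : ∀ τ, φ (δ τ) * φ (δ τ) = ∑ a : (Fin (d + 1) → n), ∑ b : (Fin (d + 1) → n),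
          φ (c a b) * (φ (δ τ) * (if b = a ∘ τ then 1 else 0)) := by
        intro τ
        nth_rewrite 1 [h2 τ]
        simp_rw [Finset.sum_mul]
        refine Finset.sum_congr rfl fun a _ => Finset.sum_congr rfl fun b _ => by ring
      simp_rw [this]
      rw [Finset.sum_comm]
      refine Finset.sum_eq_zero fun a _ => ?_
      rw [Finset.sum_comm]
      refine Finset.sum_eq_zero fun b _ => ?_
      rw [← Finset.mul_sum, h1, mul_zero]
    intro τ
    exact mul_self_eq_zero.1
      ((Finset.sum_eq_zero_iff_of_nonneg fun _ _ => mul_self_nonneg _).1 h3 τ (Finset.mem_univ τ))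
  exact sub_eq_zero.1 ((Module.forall_dual_apply_eq_zero_iff ℚ (δ σ)).1 fun φ => hzero φ σ)

/-- Trace monomials of length at most `n²` determine all trace monomials. -/
theorem trace_congr_of_length_le [CharZero K] {n α : Type*} [Fintype n] [DecidableEq n]
    {A A' : α → Matrix n n K}
    (h : ∀ w : List α, w ≠ [] → w.length ≤ Fintype.card n ^ 2 →
      trace (w.map A).prod = trace (w.map A').prod) (w : List α) :
    trace (w.map A).prod = trace (w.map A').prod := by
  suffices H : ∀ N, ∀ w : List α, w ≠ [] → w.length ≤ N →
      trace (w.map A).prod = trace (w.map A').prod by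
    by_cases hw : w = []
    · simp [hw]
    · exact H _ w hw le_rfl
  intro N
  induction N with
  | zero => intro w hw hl; simp_all
  | succ N ih =>
    intro w hw hl
    by_cases hN : w.length ≤ N
    · exact ih w hw hN
    by_cases hm : N + 1 ≤ Fintype.card n ^ 2
    · exact h w hw (hl.trans hm)
    have hlen : w.length = N + 1 := by omega
    obtain ⟨u, rfl⟩ : ∃ u : Fin (N + 1) → α, w = List.ofFn u :=
      ⟨fun k => w.get (k.cast hlen.symm), by
        apply List.ext_get <;> simp [hlen, -List.ofFn_succ]⟩
    have := permTrace_congr_of_card_lt (by omega) (A ∘ u) (A' ∘ u)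
      (fun σ hσ => permTrace_congr_of_not_isConj (permTrace_congr_of_trace N ih) u σ hσ)
      (finRotate (N + 1))
    rw [permTrace_finRotate, permTrace_finRotate] at this
    rwa [List.map_ofFn, List.map_ofFn]

end Reduction

section Polarization

variable {K V ι : Type*} [Field K] [AddCommGroup V] [Module K V] [Fintype ι] [DecidableEq ι]

/-- Polarization: a multilinear map vanishing on the diagonal has zero symmetrization. -/
theorem MultilinearMap.sum_perm_eq_zero_of_diagonal (φ : MultilinearMap K (fun _ : ι => V) K)
    (h : ∀ x, φ (fun _ => x) = 0) (v : ι → V) : ∑ τ : Equiv.Perm ι, φ (v ∘ τ) = 0 := by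
  have hcoeff : ∀ s : ι → ι, ∑ S : Finset ι, (-1 : K) ^ S.card *
      (if ∀ i, s i ∈ S then 1 else 0) =
        ∏ k, ((-1 : K) + if k ∈ Set.range s then 0 else 1) := by
    classical
    intro s
    rw [Finset.prod_add, Finset.powerset_univ]
    refine Finset.sum_congr rfl fun S _ => ?_
    rw [Finset.prod_const]
    congr 1
    split_ifs with hs
    · symm
      refine Finset.prod_eq_one fun k hk => if_neg ?_
      rintro ⟨i, rfl⟩
      simp [hs i] at hk
    · push Not at hs
      obtain ⟨i, hi⟩ := hs
      refine Eq.symm (Finset.prod_eq_zero (i := s i) ?_ ?_)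
      · simp [hi]
      · exact if_pos ⟨i, rfl⟩
  have hsum : ∑ s : ι → ι, (∏ k, ((-1 : K) + if k ∈ Set.range s then 0 else 1)) * φ (v ∘ s) = 0 := by
    simp_rw [← hcoeff, Finset.sum_mul]
    rw [Finset.sum_comm]
    refine Finset.sum_eq_zero fun S _ => ?_
    have hS := h (∑ k ∈ S, v k)
    rw [φ.map_sum_finset (fun _ k => v k) (fun _ => S)] at hS
    simp_rw [mul_assoc]
    rw [← Finset.mul_sum]
    refine mul_eq_zero_of_right _ (Eq.trans ?_ hS)
    rw [← Finset.sum_subset (Finset.subset_univ (Fintype.piFinset fun _ : ι => S))]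
    · refine Finset.sum_congr rfl fun s hs => ?_
      rw [if_pos (by simpa using hs), one_mul]
      rfl
    · intro s _ hs
      rw [if_neg (by simpa using hs), zero_mul]
  have hperm : ∑ τ : Equiv.Perm ι, (-1 : K) ^ Fintype.card ι * φ (v ∘ τ) = 0 := by
    rw [← hsum]
    refine Fintype.sum_of_injective (fun τ : Equiv.Perm ι => (τ : ι → ι)) DFunLike.coe_injective
      _ _ ?_ ?_
    · intro s hs
      have hns : ¬ Function.Surjective s := fun hsurj =>
        hs ⟨Equiv.ofBijective s (Finite.surjective_iff_bijective.1 hsurj), rfl⟩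
      obtain ⟨k, hk⟩ := not_forall.1 hns
      exact mul_eq_zero_of_left (Finset.prod_eq_zero (Finset.mem_univ k)
        (by rw [if_neg (by simpa using hk)]; simp)) _
    · intro τ
      simp [τ.surjective.range_eq]
  rw [← Finset.mul_sum] at hperm
  exact (mul_eq_zero.1 hperm).resolve_left (by simp)

end Polarization

section DoubleCentralizer

/-- Double centralizer property for a finite group of matrices. -/
theorem mem_span_range_of_commute_centralizer {K G I : Type*} [Field K] [CharZero K] [Group G]
    [Fintype G] [Fintype I] [DecidableEq I] (ρ : G →* Matrix I I K) (T : Matrix I I K)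
    (hT : ∀ C : Matrix I I K, (∀ g, C * ρ g = ρ g * C) → C * T = T * C) :
    T ∈ Submodule.span K (Set.range ρ) := by
  set S := Submodule.span K (Set.range ρ)
  have hmem : ∀ g, ρ g ∈ S := fun g => Submodule.subset_span ⟨g, rfl⟩
  have hmul : ∀ g, ∀ X ∈ S, ρ g * X ∈ S := by
    intro g X hX
    induction hX using Submodule.span_induction with
    | mem x hx =>
      obtain ⟨h, rfl⟩ := hx
      rw [← map_mul]
      exact hmem _
    | zero => simp
    | add x y _ _ hx hy => rw [mul_add]; exact S.add_mem hx hy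
    | smul c x _ hx => rw [mul_smul_comm]; exact S.smul_mem c hx
  obtain ⟨q, hq⟩ := S.subtype.exists_leftInverse_of_injective (Submodule.ker_subtype S)
  have hq' : ∀ X (hX : X ∈ S), (q X : Matrix I I K) = X := fun X hX =>
    congrArg Subtype.val (LinearMap.congr_fun hq ⟨X, hX⟩)
  -- The averaged projection onto `S`.
  let π : Matrix I I K →ₗ[K] Matrix I I K := (Fintype.card G : K)⁻¹ • ∑ g,
    (LinearMap.mulLeft K (ρ g)) ∘ₗ S.subtype ∘ₗ q ∘ₗ LinearMap.mulLeft K (ρ g⁻¹)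
  have hπ : ∀ X, π X = (Fintype.card G : K)⁻¹ • ∑ g, ρ g * (q (ρ g⁻¹ * X) : Matrix I I K) := by
    intro X
    simp [π]
  have hπS : ∀ X, π X ∈ S := by
    intro X
    rw [hπ]
    exact S.smul_mem _ (S.sum_mem fun g _ => hmul g _ (q _).2)
  have hπ1 : π 1 = 1 := by
    rw [hπ, Finset.sum_congr rfl (g := fun _ => 1)]
    · rw [Finset.sum_const, Finset.card_univ, ← Nat.cast_smul_eq_nsmul K, smul_smul,
        inv_mul_cancel₀ (Nat.cast_ne_zero.2 Fintype.card_ne_zero), one_smul]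
    · intro g _
      rw [mul_one, hq' _ (hmem _), ← map_mul, mul_inv_cancel, map_one]
  have hπρ : ∀ g X, π (ρ g * X) = ρ g * π X := by
    intro g X
    rw [hπ, hπ, mul_smul_comm, Finset.mul_sum, ← Equiv.sum_comp (Equiv.mulLeft g)]
    congr 1
    refine Finset.sum_congr rfl fun h _ => ?_
    simp only [Equiv.coe_mulLeft, _root_.mul_inv_rev, map_mul, mul_assoc]
    rw [← mul_assoc (ρ g⁻¹) (ρ g), ← map_mul ρ g⁻¹ g, inv_mul_cancel, map_one, one_mul]
  have hsingle : ∀ Z : Matrix I I K, ∀ a b,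
      π Z a b = ∑ c, ∑ e, Z e c * π (Matrix.single e c 1) a b := by
    intro Z a b
    conv_lhs => rw [Matrix.matrix_eq_sum_single Z]
    rw [Finset.sum_comm]
    simp only [map_sum, Matrix.sum_apply]
    refine Finset.sum_congr rfl fun c _ => Finset.sum_congr rfl fun e _ => ?_
    rw [← mul_one (Z e c), ← smul_eq_mul, ← Matrix.smul_single, map_smul]
    simp
  have hπT : π T = T := by
    ext a b
    have hN : ∀ c : I, (Matrix.of fun a e => π (Matrix.single e c 1) a b) * T =
        T * Matrix.of fun a e => π (Matrix.single e c 1) a b := by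
      intro c
      refine hT _ fun g => ?_
      ext x y
      have := congrFun (congrFun (hπρ g (Matrix.single y c 1)) x) b
      rw [hsingle, Matrix.mul_apply] at this
      simp only [Matrix.mul_apply, Matrix.of_apply]
      rw [← this]
      symm
      rw [Finset.sum_eq_single c]
      · refine Finset.sum_congr rfl fun e _ => ?_
        rw [Matrix.mul_single_apply_same, mul_one, mul_comm]
      · intro c' _ hc'
        refine Finset.sum_eq_zero fun e _ => ?_
        rw [Matrix.mul_single_apply_of_ne _ _ _ _ _ hc', zero_mul]
      · simp
    calc π T a b = ∑ c, ((Matrix.of fun a e => π (Matrix.single e c 1) a b) * T) a c := by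
          rw [hsingle]
          simp only [Matrix.mul_apply, Matrix.of_apply, mul_comm]
      _ = ∑ c, (T * Matrix.of fun a e => π (Matrix.single e c 1) a b) a c := by simp_rw [hN]
      _ = (T * π 1) a b := by
          simp only [Matrix.mul_apply, Matrix.of_apply]
          rw [Finset.sum_comm]
          refine Finset.sum_congr rfl fun e _ => ?_
          rw [← Finset.mul_sum, hsingle 1 e b]
          congr 1
          refine Finset.sum_congr rfl fun c _ => ?_
          simp [Matrix.one_apply]
      _ = T a b := by rw [hπ1, mul_one]
  exact hπT ▸ hπS T

end DoubleCentralizer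

section FirstFundamentalTheorem

variable {K n : Type*} [Field K] [Fintype n] [DecidableEq n]

/-- The action of `S_d` on the `d`-th tensor power of `n → K`. -/
def tensorPerm (K n : Type*) [Field K] [Fintype n] [DecidableEq n] (d : ℕ) :
    Equiv.Perm (Fin d) →* Matrix (Fin d → n) (Fin d → n) K where
  toFun σ := Matrix.of fun a b => if a ∘ σ = b then 1 else 0
  map_one' := by
    ext a b
    simp [Matrix.one_apply]
  map_mul' σ τ := by
    ext a b
    simp only [Matrix.mul_apply, Matrix.of_apply, ite_mul, one_mul, zero_mul, Finset.sum_ite_eq,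
      Finset.mem_univ, if_true]
    rfl

theorem tensorPerm_apply {d : ℕ} (σ : Equiv.Perm (Fin d)) (a b : Fin d → n) :
    tensorPerm K n d σ a b = if a ∘ σ = b then 1 else 0 := rfl

/-- A matrix commuting with the action of `S_d` has entries invariant under simultaneous
permutation. -/
theorem apply_comp_perm_of_commute {d : ℕ} {C : Matrix (Fin d → n) (Fin d → n) K}
    (hC : ∀ σ, C * tensorPerm K n d σ = tensorPerm K n d σ * C) (σ : Equiv.Perm (Fin d))
    (a b : Fin d → n) : C (a ∘ σ) (b ∘ σ) = C a b := by
  have h := congrFun (congrFun (hC σ) a) (b ∘ σ)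
  simp only [Matrix.mul_apply, tensorPerm_apply] at h
  have hcomp : ∀ c : Fin d → n, c ∘ σ = b ∘ σ ↔ c = b := fun c =>
    σ.surjective.injective_comp_right.eq_iff
  simpa [hcomp] using h.symm

theorem MultilinearMap.apply_eq_sum_single {d : ℕ}
    (G : MultilinearMap K (fun _ : Fin d => Matrix n n K) K) (X : Fin d → Matrix n n K) :
    G X = ∑ a : Fin d → n, ∑ b : Fin d → n,
      (∏ k, X k (a k) (b k)) * G fun k => Matrix.single (a k) (b k) 1 := by
  have hX : X = fun k => ∑ p : n × n, X k p.1 p.2 • Matrix.single p.1 p.2 (1 : K) := by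
    funext k
    conv_lhs => rw [Matrix.matrix_eq_sum_single (X k)]
    rw [Fintype.sum_prod_type]
    simp
  conv_lhs => rw [hX]
  rw [G.map_sum, ← Fintype.sum_prod_type']
  refine Fintype.sum_equiv (Equiv.arrowProdEquivProdArrow (Fin d) (fun _ => n) (fun _ => n))
    _ _ fun s => ?_
  rw [G.map_smul_univ, smul_eq_mul]
  rfl

/-- A multilinear map vanishing at `(P, …, P)` for all invertible matrices `P` does so for
all matrices `P`. -/
theorem MultilinearMap.diagonal_eq_zero_of_det_ne_zero [CharZero K] {d : ℕ}
    (φ : MultilinearMap K (fun _ : Fin d => Matrix n n K) K)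
    (h : ∀ P : Matrix n n K, P.det ≠ 0 → φ (fun _ => P) = 0) (P : Matrix n n K) :
    φ (fun _ => P) = 0 := by
  classical
  let q : Polynomial K := ∑ s : Finset (Fin d),
    Polynomial.C (φ (s.piecewise (fun _ => P) fun _ => 1)) * Polynomial.X ^ sᶜ.card
  have hq : ∀ t, q.eval t = φ (fun _ => P + t • 1) := by
    intro t
    have := φ.map_add_univ (fun _ => P) (fun _ => t • 1)
    change _ = φ ((fun _ => P) + fun _ => t • 1)
    rw [this, Polynomial.eval_finsetSum]
    refine Finset.sum_congr rfl fun s _ => ?_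
    have hs : s.piecewise (fun _ => P) (fun _ => t • (1 : Matrix n n K)) =
        fun k => (s.piecewise (fun _ => (1 : K)) (fun _ => t) k) •
          (s.piecewise (fun _ => P) (fun _ => (1 : Matrix n n K)) k) := by
      funext k
      by_cases hk : k ∈ s <;> simp [hk]
    rw [hs, φ.map_smul_univ, Finset.prod_piecewise]
    simp only [Finset.prod_const, one_pow, one_mul, Polynomial.eval_mul, Polynomial.eval_C,
      Polynomial.eval_pow, Polynomial.eval_X, smul_eq_mul]
    rw [mul_comm, Finset.compl_eq_univ_sdiff]
  have hzero : q * (-P).charpoly = 0 := by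
    refine Polynomial.funext fun t => ?_
    rw [Polynomial.eval_mul, Matrix.eval_charpoly, hq, Polynomial.eval_zero]
    by_cases hdet : (P + t • (1 : Matrix n n K)).det = 0
    · refine mul_eq_zero_of_right _ ?_
      rw [← hdet]
      congr 1
      rw [sub_neg_eq_add, add_comm, Matrix.smul_one_eq_diagonal, Matrix.scalar_apply]
    · rw [h _ hdet, zero_mul]
  have hq0 : q = 0 := (mul_eq_zero.1 hzero).resolve_right (Matrix.charpoly_monic _).ne_zero
  have := hq 0
  rw [hq0] at this
  simpa using this.symm

theorem MultilinearMap.apply_mul_comm_of_det_ne_zero [IsAlgClosed K] [Nonempty n] {d : ℕ}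
    (G : MultilinearMap K (fun _ : Fin d => Matrix n n K) K)
    (hG : ∀ (P : Matrix.SpecialLinearGroup n K) (X : Fin d → Matrix n n K),
      G (fun k => P.1 * X k * (P⁻¹).1) = G X)
    (P : Matrix n n K) (hP : P.det ≠ 0) (X : Fin d → Matrix n n K) :
    G (fun k => P * X k) = G (fun k => X k * P) := by
  obtain ⟨c, hc⟩ := IsAlgClosed.exists_pow_nat_eq P.det (Fintype.card_pos (α := n))
  have hc0 : c ≠ 0 := by
    rintro rfl
    rw [zero_pow Fintype.card_ne_zero] at hc
    exact hP hc.symm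
  let Q : Matrix.SpecialLinearGroup n K := ⟨c⁻¹ • P, by
    rw [Matrix.det_smul, ← hc, inv_pow, inv_mul_cancel₀ (pow_ne_zero _ hc0)]⟩
  have hPQ : P = c • Q.1 := by simp [Q, smul_smul, hc0]
  have hQ : (Q.1 * (Q⁻¹).1 : Matrix n n K) = 1 := by
    rw [← Matrix.SpecialLinearGroup.coe_mul, mul_inv_cancel, Matrix.SpecialLinearGroup.coe_one]
  have h := hG Q (fun k => X k * Q.1)
  simp only [mul_assoc, hQ, mul_one] at h
  simp only [hPQ, Matrix.smul_mul, Matrix.mul_smul]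
  rw [G.map_smul_univ (fun _ => c), G.map_smul_univ (fun _ => c), h]

/-- **First fundamental theorem** for matrix invariants, multilinear case: a multilinear
conjugation invariant is determined by the permutation traces. -/
theorem MultilinearMap.congr_of_permTrace [IsAlgClosed K] [CharZero K] [Nonempty n] {d : ℕ}
    (G : MultilinearMap K (fun _ : Fin d => Matrix n n K) K)
    (hG : ∀ (P : Matrix.SpecialLinearGroup n K) (X : Fin d → Matrix n n K),
      G (fun k => P.1 * X k * (P⁻¹).1) = G X)
    {X Y : Fin d → Matrix n n K}
    (hXY : ∀ σ : Equiv.Perm (Fin d), permTrace σ X = permTrace σ Y) : G X = G Y := by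
  let T : Matrix (Fin d → n) (Fin d → n) K :=
    Matrix.of fun a b => G fun k => Matrix.single (b k) (a k) 1
  have hsingle : ∀ a b a' b' : Fin d → n,
      G (fun k => Matrix.single (a k) (b k) 1 * Matrix.single (a' k) (b' k) 1) =
        if b = a' then T b' a else 0 := by
    intro a b a' b'
    split_ifs with h
    · subst h
      simp [T]
    · obtain ⟨k, hk⟩ := Function.ne_iff.1 h
      exact G.map_coord_zero k (Matrix.single_mul_single_of_ne _ _ _ _ hk _)
  have hsymm : ∀ a b i j : Fin d → n, ∑ τ : Equiv.Perm (Fin d),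
      ((if j ∘ τ = b then T a (i ∘ τ) else 0) - if a = i ∘ τ then T (j ∘ τ) b else 0) = 0 := by
    intro a b i j
    let φ : MultilinearMap K (fun _ : Fin d => Matrix n n K) K :=
      G.compLinearMap (fun k => LinearMap.mulRight K (Matrix.single (b k) (a k) (1 : K))) -
        G.compLinearMap (fun k => LinearMap.mulLeft K (Matrix.single (b k) (a k) (1 : K)))
    have hφ : ∀ P, φ (fun _ => P) = 0 := φ.diagonal_eq_zero_of_det_ne_zero fun P hP => by
      simp only [φ, _root_.sub_apply, MultilinearMap.compLinearMap_apply,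
        LinearMap.mulRight_apply, LinearMap.mulLeft_apply]
      rw [G.apply_mul_comm_of_det_ne_zero hG P hP, sub_self]
    refine Eq.trans (Finset.sum_congr rfl fun τ _ => ?_)
      (φ.sum_perm_eq_zero_of_diagonal hφ fun k => Matrix.single (i k) (j k) 1)
    simp only [φ, _root_.sub_apply, MultilinearMap.compLinearMap_apply,
      LinearMap.mulRight_apply, LinearMap.mulLeft_apply]
    exact congrArg₂ (· - ·) (hsingle (i ∘ τ) (j ∘ τ) b a).symm (hsingle b a (i ∘ τ) (j ∘ τ)).symm
  have hT : T ∈ Submodule.span K (Set.range (tensorPerm K n d)) := by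
    refine mem_span_range_of_commute_centralizer _ _ fun C hC => ?_
    have hCσ := apply_comp_perm_of_commute hC
    ext a b
    have hτ : ∀ τ : Equiv.Perm (Fin d), ∑ i, ∑ j, C i j *
        ((if j ∘ τ = b then T a (i ∘ τ) else 0) - if a = i ∘ τ then T (j ∘ τ) b else 0) =
          (T * C) a b - (C * T) a b := by
      intro τ
      have hbase : ∑ i, ∑ j, C i j * ((if j = b then T a i else 0) - if a = i then T j b else 0) =
          (T * C) a b - (C * T) a b := by
        simp only [Matrix.mul_apply, mul_sub, Finset.sum_sub_distrib, mul_ite, mul_zero,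
          Finset.sum_ite_eq', Finset.mem_univ, if_true]
        congr 1
        · exact Finset.sum_congr rfl fun i _ => mul_comm _ _
        · rw [Finset.sum_comm]
          simp
      let e : (Fin d → n) ≃ (Fin d → n) := τ.symm.arrowCongr (Equiv.refl n)
      rw [← hbase]
      conv_rhs => rw [← Equiv.sum_comp e]
      refine Finset.sum_congr rfl fun i _ => ?_
      conv_rhs => rw [← Equiv.sum_comp e]
      refine Finset.sum_congr rfl fun j _ => ?_
      rw [show C (e i) (e j) = C i j from hCσ τ i j]
      rfl
    have hsum : ∑ _τ : Equiv.Perm (Fin d), ((T * C) a b - (C * T) a b) = 0 := by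
      rw [Finset.sum_congr rfl fun τ _ => (hτ τ).symm]
      rw [Finset.sum_comm]
      refine Finset.sum_eq_zero fun i _ => ?_
      rw [Finset.sum_comm]
      refine Finset.sum_eq_zero fun j _ => ?_
      rw [← Finset.mul_sum, hsymm, mul_zero]
    rw [Finset.sum_const, smul_eq_zero] at hsum
    exact (sub_eq_zero.1 (hsum.resolve_left (by simp [Fintype.card_ne_zero]))).symm
  have hexp : ∀ Z, G Z = ∑ a : Fin d → n, ∑ b : Fin d → n, (∏ k, Z k (a k) (b k)) * T b a :=
    G.apply_eq_sum_single
  suffices hspan : ∀ S ∈ Submodule.span K (Set.range (tensorPerm K n d)),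
      ∑ a : Fin d → n, ∑ b : Fin d → n, (∏ k, X k (a k) (b k)) * S b a =
        ∑ a : Fin d → n, ∑ b : Fin d → n, (∏ k, Y k (a k) (b k)) * S b a by
    rw [hexp, hexp, hspan T hT]
  intro S hS
  induction hS using Submodule.span_induction with
  | mem S hS =>
    obtain ⟨σ, rfl⟩ := hS
    have htr : ∀ Z : Fin d → Matrix n n K, ∑ a : Fin d → n, ∑ b : Fin d → n,
        (∏ k, Z k (a k) (b k)) * tensorPerm K n d σ b a = permTrace σ⁻¹ Z := by
      intro Z
      rw [Finset.sum_comm, permTrace]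
      refine Fintype.sum_equiv (σ.symm.arrowCongr (Equiv.refl n)) _ _ fun b => ?_
      simp [tensorPerm_apply, Equiv.arrowCongr]
    rw [htr, htr, hXY]
  | zero => simp
  | add S S' _ _ h h' => simp only [Matrix.add_apply, mul_add, Finset.sum_add_distrib, h, h']
  | smul c S _ h =>
    simp only [Matrix.smul_apply, smul_eq_mul, mul_left_comm _ c, ← Finset.mul_sum, h]

end FirstFundamentalTheorem

section Invariants

variable {K : Type*} [Field K]

/-- A homogeneous polynomial of degree `d` is the restriction to the diagonal of a `d`-linear
map. -/
theorem MvPolynomial.IsHomogeneous.exists_multilinearMap {σ : Type*} {f : MvPolynomial σ K} {d : ℕ}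
    (hf : f.IsHomogeneous d) :
    ∃ φ : MultilinearMap K (fun _ : Fin d => σ → K) K, ∀ x, φ (fun _ => x) = eval x f := by
  have hp : ∀ s : σ →₀ ℕ, ∃ p : ∑ i ∈ s.support, s i = d → Fin d → σ, ∀ h, ∀ x : σ → K,
      ∏ k, x (p h k) = s.prod fun i e => x i ^ e := by
    intro s
    by_cases h : ∑ i ∈ s.support, s i = d
    · have hlist : ∀ l : List σ, l.length = d →
          ∃ p : Fin d → σ, ∀ x : σ → K, ∏ k, x (p k) = (l.map x).prod := by
        rintro l rfl
        exact ⟨l.get, fun x => by simp⟩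
      obtain ⟨p, hp⟩ := hlist s.toMultiset.toList (by
        rw [Multiset.length_toList, Finsupp.card_toMultiset, ← h]
        rfl)
      refine ⟨fun _ => p, fun _ x => ?_⟩
      rw [hp, ← Multiset.prod_coe, ← Multiset.map_coe, Multiset.coe_toList,
        Finsupp.toMultiset_map, Finsupp.prod_toMultiset,
        Finsupp.prod_mapDomain_index pow_zero pow_add]
    · exact ⟨fun h' => absurd h' h, fun h' => absurd h' h⟩
  choose p hp using hp
  refine ⟨∑ s ∈ f.support.attach, f.coeff s • (MultilinearMap.mkPiAlgebra K (Fin d) K).compLinearMap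
    fun k => LinearMap.proj (p s (hf.degree_eq_sum_deg_support s.2).symm k), fun x => ?_⟩
  rw [MvPolynomial.eval_eq]
  conv_rhs => rw [← Finset.sum_attach]
  simp only [_root_.sum_apply, _root_.smul_apply, smul_eq_mul,
    MultilinearMap.compLinearMap_apply, MultilinearMap.mkPiAlgebra_apply, LinearMap.proj_apply]
  refine Finset.sum_congr rfl fun s _ => ?_
  rw [hp]
  rfl

theorem isMatrixInvariant_homogeneousComponent [CharZero K] {r m : ℕ}
    {f : MvPolynomial (Fin r × Fin m × Fin m) K} (hf : IsMatrixInvariant K r m f) (d : ℕ) :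
    IsMatrixInvariant K r m (homogeneousComponent d f) := by
  intro P B
  have hscale : ∀ (t : K) (x : Fin r × Fin m × Fin m → K), eval (t • x) f =
      (∑ e ∈ Finset.range (f.totalDegree + 1),
        Polynomial.C (eval x (homogeneousComponent e f)) * Polynomial.X ^ e).eval t := by
    intro t x
    conv_lhs => rw [← sum_homogeneousComponent f]
    rw [map_sum, Polynomial.eval_finsetSum]
    refine Finset.sum_congr rfl fun e _ => ?_
    obtain ⟨φ, hφ⟩ := (homogeneousComponent_isHomogeneous e f).exists_multilinearMap
    rw [← hφ, ← hφ, φ.map_smul_univ (fun _ => t) (fun _ => x)]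
    simp only [Finset.prod_const, Finset.card_univ, Fintype.card_fin, smul_eq_mul,
      Polynomial.eval_mul, Polynomial.eval_C, Polynomial.eval_pow, Polynomial.eval_X]
    exact mul_comm _ _
  by_cases hd : d < f.totalDegree + 1
  swap
  · rw [homogeneousComponent_eq_zero d f (by omega), map_zero, map_zero]
  let q (x : Fin r × Fin m × Fin m → K) : Polynomial K :=
    ∑ e ∈ Finset.range (f.totalDegree + 1),
      Polynomial.C (eval x (homogeneousComponent e f)) * Polynomial.X ^ e
  have hpoly : q (fun p => (P.1 * B p.1 * (P⁻¹).1) p.2.1 p.2.2) =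
      q (fun p => B p.1 p.2.1 p.2.2) := by
    refine Polynomial.funext fun t => ?_
    rw [← hscale, ← hscale]
    refine Eq.trans ?_ (hf P fun i => t • B i)
    congr 2
    funext p
    simp only [Matrix.mul_smul, Matrix.smul_mul, Matrix.smul_apply, Pi.smul_apply]
  have := congrArg (Polynomial.coeff · d) hpoly
  simpa [q, Polynomial.finsetSum_coeff, Polynomial.coeff_X_pow, hd] using this

theorem eval_congr_of_isHomogeneous [IsAlgClosed K] [CharZero K] {r m : ℕ} (hm : 1 ≤ m)
    {f : MvPolynomial (Fin r × Fin m × Fin m) K} (hf : IsMatrixInvariant K r m f) {d : ℕ}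
    (hd : f.IsHomogeneous d) {A A' : Fin r → Matrix (Fin m) (Fin m) K}
    (h : ∀ (u : Fin d → Fin r) (σ : Equiv.Perm (Fin d)),
      permTrace σ (A ∘ u) = permTrace σ (A' ∘ u)) :
    eval (fun p => A p.1 p.2.1 p.2.2) f = eval (fun p => A' p.1 p.2.1 p.2.2) f := by
  have : Nonempty (Fin m) := ⟨⟨0, hm⟩⟩
  obtain ⟨ψ, hψ⟩ := hd.exists_multilinearMap
  let φ : MultilinearMap K (fun _ : Fin d => Fin r → Matrix (Fin m) (Fin m) K) K :=
    ψ.compLinearMap fun _ => LinearMap.pi fun p =>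
      Matrix.entryLinearMap K K p.2.1 p.2.2 ∘ₗ LinearMap.proj p.1
  have hφ : ∀ B, φ (fun _ => B) = eval (fun p => B p.1 p.2.1 p.2.2) f := fun B => hψ _
  let Φ : MultilinearMap K (fun _ : Fin d => Fin r → Matrix (Fin m) (Fin m) K) K :=
    ∑ τ : Equiv.Perm (Fin d), φ.domDomCongr τ
  have hΦ : ∀ v, Φ v = ∑ τ : Equiv.Perm (Fin d), φ (v ∘ τ) := fun v => by
    simp only [Φ, _root_.sum_apply]
    rfl
  have hinv : ∀ (P : Matrix.SpecialLinearGroup (Fin m) K) v,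
      Φ (fun k i => P.1 * v k i * (P⁻¹).1) = Φ v := by
    intro P v
    let L : (Fin r → Matrix (Fin m) (Fin m) K) →ₗ[K] (Fin r → Matrix (Fin m) (Fin m) K) :=
      LinearMap.pi fun i => LinearMap.mulRight K (P⁻¹).1 ∘ₗ LinearMap.mulLeft K P.1 ∘ₗ
        LinearMap.proj i
    have hL : ∀ B, φ (fun _ => L B) = φ fun _ => B := fun B => by
      rw [hφ, hφ]
      exact hf P B
    have hsum := (φ.compLinearMap (fun _ => L) - φ).sum_perm_eq_zero_of_diagonal
      (fun B => by
        rw [_root_.sub_apply, MultilinearMap.compLinearMap_apply, hL, sub_self]) v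
    simp only [_root_.sub_apply, MultilinearMap.compLinearMap_apply,
      Finset.sum_sub_distrib, sub_eq_zero] at hsum
    rw [hΦ, hΦ]
    exact hsum
  have hexp : ∀ B : Fin r → Matrix (Fin m) (Fin m) K,
      (Fintype.card (Equiv.Perm (Fin d)) : K) * eval (fun p => B p.1 p.2.1 p.2.2) f =
        ∑ u : Fin d → Fin r, Φ fun k => Pi.single (u k) (B (u k)) := by
    intro B
    have hB := Φ.map_sum (fun (_ : Fin d) (i : Fin r) => Pi.single i (B i))
    simp only [Finset.univ_sum_single] at hB
    rw [← hB, hΦ, ← hφ, ← nsmul_eq_mul, ← Finset.card_univ, ← Finset.sum_const]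
    rfl
  refine mul_left_cancel₀ (Nat.cast_ne_zero.2 (Fintype.card_ne_zero (α := Equiv.Perm (Fin d))))
    ((hexp A).trans (Eq.trans ?_ (hexp A').symm))
  refine Finset.sum_congr rfl fun u _ => ?_
  refine (Φ.compLinearMap fun k => LinearMap.single K (fun _ => Matrix (Fin m) (Fin m) K)
    (u k)).congr_of_permTrace (fun P X => ?_) (h u)
  simp only [MultilinearMap.compLinearMap_apply, LinearMap.coe_single]
  refine Eq.trans ?_ (hinv P _)
  congr 1
  funext k i
  by_cases hi : i = u k
  · subst hi
    simp
  · simp [hi]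

/-- Trace monomials are conjugation invariant polynomials. -/
theorem exists_isMatrixInvariant_eval_eq_trace {r m : ℕ} (w : List (Fin r)) :
    ∃ f : MvPolynomial (Fin r × Fin m × Fin m) K, IsMatrixInvariant K r m f ∧
      ∀ B : Fin r → Matrix (Fin m) (Fin m) K,
        eval (fun p => B p.1 p.2.1 p.2.2) f = trace (w.map B).prod := by
  let f : MvPolynomial (Fin r × Fin m × Fin m) K :=
    trace (w.map fun i => Matrix.of fun a b => (X (i, a, b) : MvPolynomial _ K)).prod
  have hf : ∀ B : Fin r → Matrix (Fin m) (Fin m) K,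
      eval (fun p => B p.1 p.2.1 p.2.2) f = trace (w.map B).prod := by
    intro B
    rw [AddMonoidHom.map_trace (eval fun p : Fin r × Fin m × Fin m => B p.1 p.2.1 p.2.2),
      ← RingHom.mapMatrix_apply, map_list_prod, List.map_map]
    congr 3
    funext i
    ext a b
    simp
  refine ⟨f, fun P B => ?_, hf⟩
  have hP : ((P⁻¹).1 * P.1 : Matrix (Fin m) (Fin m) K) = 1 := by
    rw [← Matrix.SpecialLinearGroup.coe_mul, inv_mul_cancel, Matrix.SpecialLinearGroup.coe_one]
  have hP' : (P.1 * (P⁻¹).1 : Matrix (Fin m) (Fin m) K) = 1 := by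
    rw [← Matrix.SpecialLinearGroup.coe_mul, mul_inv_cancel, Matrix.SpecialLinearGroup.coe_one]
  have hconj : ∀ l : List (Fin r), (l.map fun i => P.1 * B i * (P⁻¹).1).prod =
      P.1 * (l.map B).prod * (P⁻¹).1 := by
    intro l
    induction l with
    | nil => simp only [List.map_nil, List.prod_nil, mul_one, hP']
    | cons i l ih =>
      rw [List.map_cons, List.prod_cons, ih, List.map_cons, List.prod_cons]
      simp only [mul_assoc]
      rw [← mul_assoc (P⁻¹).1 P.1, hP, one_mul]
  rw [hf, hf fun i => P.1 * B i * (P⁻¹).1, hconj, Matrix.trace_mul_comm, ← mul_assoc, hP, one_mul]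

end Invariants

/-- Two `r`-tuples of `m × m` matrices take equal values under every
`SL_m`-invariant polynomial iff all their trace monomials
`trace(A_{i₁} ⋯ A_{i_l})` over words of length `l ≤ m²` agree. -/
theorem invariants_agree_iff_traces_agree
    (K : Type*) [Field K] [IsAlgClosed K] [CharZero K] (m r : ℕ)
    (hm : 1 ≤ m) (hr : 1 ≤ r)
    (A A' : Fin r → Matrix (Fin m) (Fin m) K) :
    (∀ f : MvPolynomial (Fin r × Fin m × Fin m) K, IsMatrixInvariant K r m f →
        MvPolynomial.eval (fun p => A p.1 p.2.1 p.2.2) f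
          = MvPolynomial.eval (fun p => A' p.1 p.2.1 p.2.2) f)
      ↔ ∀ w : List (Fin r), w ≠ [] → w.length ≤ m ^ 2 →
          Matrix.trace (w.map A).prod = Matrix.trace (w.map A').prod := by
  constructor
  · intro h w _ _
    obtain ⟨f, hf, hw⟩ := exists_isMatrixInvariant_eval_eq_trace (K := K) (m := m) w
    rw [← hw, ← hw, h f hf]
  · intro h f hf
    have htrace := trace_congr_of_length_le (A := A) (A' := A') (by simpa using h)
    rw [← sum_homogeneousComponent f, map_sum, map_sum]
    refine Finset.sum_congr rfl fun d _ => ?_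
    exact eval_congr_of_isHomogeneous hm (isMatrixInvariant_homogeneousComponent hf d)
      (homogeneousComponent_isHomogeneous d f)
      (permTrace_congr_of_trace d (fun w _ _ => htrace w) d le_rfl)
end
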